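/- arXiv:2009.14442 — 2 statements merged into one kernel-verified Lean document; each statement's English description precedes it below -/
import Mathlib

section
/- Let λ < λ_c be fixed and suppose the edge-probability satisfies p(n) ≤ λ n^{-1/2}. Then there is a constant C = C(λ) > 0 such that for Γ ∈ G(n,p), asymptotically almost surely every square-component of Γ covers at most C·(log n)^{2^{32}} vertices. -/
open MeasureTheory Filter

noncomputable section

/-- The critical constant `λ_c = √(√6 - 2)`. -/
def lambdaC : ℝ := Real.sqrt (Real.sqrt 6 - 2)

/-- The Bernoulli measure on `Bool` with success probability `p`. -/
def bernoulliBool (p : ℝ) : Measure Bool :=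
  ENNReal.ofReal p • Measure.dirac true + ENNReal.ofReal (1 - p) • Measure.dirac false

/-- The Erdős–Rényi measure: each potential edge of a graph on `Fin n` is present
independently with probability `p`. -/
def erMeasure (n : ℕ) (p : ℝ) : Measure (Sym2 (Fin n) → Bool) :=
  Measure.pi fun _ => bernoulliBool p

/-- The graph determined by a Boolean function on unordered pairs. -/
def graphOf {n : ℕ} (ω : Sym2 (Fin n) → Bool) : SimpleGraph (Fin n) :=
  SimpleGraph.fromRel fun x y => ω s(x, y) = true

/-- `e` is a non-edge of `Γ`: a pair of distinct non-adjacent vertices. -/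
def IsNonEdge {V : Type*} (Γ : SimpleGraph V) (e : Sym2 V) : Prop :=
  ¬ e.IsDiag ∧ e ∉ Γ.edgeSet

/-- Two pairs are related if they are the diagonals of an induced 4-cycle of `Γ`. -/
def squareAdj {V : Type*} (Γ : SimpleGraph V) (e f : Sym2 V) : Prop :=
  ∃ a b c d : V, e = s(a, c) ∧ f = s(b, d) ∧ a ≠ c ∧ b ≠ d ∧
    ¬ Γ.Adj a c ∧ ¬ Γ.Adj b d ∧ Γ.Adj a b ∧ Γ.Adj b c ∧ Γ.Adj c d ∧ Γ.Adj d a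

/-- The square-graph `□(Γ)`: vertices are pairs (its relevant vertices being non-edges of
`Γ`), and edges join the two diagonals of each induced 4-cycle of `Γ`. -/
def squareGraph {V : Type*} (Γ : SimpleGraph V) : SimpleGraph (Sym2 V) :=
  SimpleGraph.fromRel (squareAdj Γ)

/-- The square-component of a pair `e`: its connected component in `□(Γ)`. -/
def squareComponent {V : Type*} (Γ : SimpleGraph V) (e : Sym2 V) : Set (Sym2 V) :=
  {f | (squareGraph Γ).Reachable e f}

/-- The support of a collection of pairs: the union of the pairs. -/
def suppOf {V : Type*} (C : Set (Sym2 V)) : Set V :=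
  {v | ∃ e ∈ C, v ∈ e}

theorem Finset.sum_biUnion_le_sum_sum {ι α : Type*} [DecidableEq α] (s : Finset ι)
    (t : ι → Finset α) (f : α → ℝ) (hf : ∀ a, 0 ≤ f a) :
    ∑ a ∈ s.biUnion t, f a ≤ ∑ i ∈ s, ∑ a ∈ t i, f a := by
  have h : s.biUnion t = (s.sigma t).image Sigma.snd := by
    ext a; simp
  rw [h]
  exact (Finset.sum_image_le_of_nonneg fun _ _ => hf _).trans_eq (Finset.sum_sigma _ _ _)

/-- A state of the exploration of a square-component: the explored vertices, the edges known
to be present, the current pair, and the explored vertices that the next pair may contain. -/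
structure ExplorationState (V : Type*) where
  old : Finset V
  cur : Sym2 V
  verts : Finset V
  edges : Finset (Sym2 V)

instance (V : Type*) : DecidableEq (ExplorationState V) := Classical.decEq _

namespace ExplorationState

variable {V : Type*} [DecidableEq V]

/-- The edges joining the vertices of `e` outside `W` to those of `c`. -/
def newEdges (W : Finset V) (c e : Sym2 V) : Finset (Sym2 V) :=
  ((e.toFinset \ W) ×ˢ c.toFinset).image fun q => s(q.1, q.2)

/-- Move from the current pair to the pair `e`. -/
def advance (s : ExplorationState V) (e : Sym2 V) : ExplorationState V :=
  ⟨s.cur.toFinset, e, s.verts ∪ e.toFinset, s.edges ∪ newEdges s.verts s.cur e⟩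

/-- The pairs with one new vertex and one allowed old vertex, or with two new vertices. -/
def nextPairs [Fintype V] (s : ExplorationState V) : Finset (Sym2 V) :=
  (s.old ×ˢ s.vertsᶜ).image (fun q => s(q.1, q.2)) ∪ s.vertsᶜ.sym2.filter fun e => ¬ e.IsDiag

/-- The states that can be reached from `s` in `l` steps. -/
def explored [Fintype V] (s : ExplorationState V) : ℕ → Finset (ExplorationState V)
  | 0 => {s}
  | l + 1 => (s.explored l).biUnion fun t => t.nextPairs.image t.advance

/-- The consistency conditions kept by the exploration. -/
structure Valid (s : ExplorationState V) : Prop where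
  cur_not_isDiag : ¬ s.cur.IsDiag
  cur_mem : s.cur ∈ s.verts.sym2
  old_subset : s.old ⊆ s.verts
  edges_subset : s.edges ⊆ s.verts.sym2

theorem toFinset_subset_iff {e : Sym2 V} {W : Finset V} : e.toFinset ⊆ W ↔ e ∈ W.sym2 := by
  simp [Finset.subset_iff, Finset.mem_sym2_iff]

theorem mem_newEdges {W : Finset V} {c e t : Sym2 V} :
    t ∈ newEdges W c e ↔ ∃ x ∈ e, x ∉ W ∧ ∃ u ∈ c, t = s(x, u) := by
  simp only [newEdges, Finset.mem_image, Finset.mem_product, Finset.mem_sdiff,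
    Sym2.mem_toFinset, Prod.exists]
  constructor
  · rintro ⟨x, u, ⟨⟨hx, hxW⟩, hu⟩, rfl⟩
    exact ⟨x, hx, hxW, u, hu, rfl⟩
  · rintro ⟨x, hx, hxW, u, hu, rfl⟩
    exact ⟨x, u, ⟨⟨hx, hxW⟩, hu⟩, rfl⟩

theorem card_edges_advance {s : ExplorationState V} (hs : s.Valid) (e : Sym2 V) :
    (s.advance e).edges.card = s.edges.card + 2 * (e.toFinset \ s.verts).card := by
  have hcur := Finset.mem_sym2_iff.1 hs.cur_mem
  have hdisj : Disjoint s.edges (newEdges s.verts s.cur e) := by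
    rw [Finset.disjoint_left]
    intro t ht ht'
    obtain ⟨x, -, hxW, u, -, rfl⟩ := mem_newEdges.1 ht'
    exact hxW (Finset.mk_mem_sym2_iff.1 (hs.edges_subset ht)).1
  rw [advance, Finset.card_union_of_disjoint hdisj, newEdges, Finset.card_image_of_injOn,
    Finset.card_product, Sym2.card_toFinset_of_not_isDiag _ hs.cur_not_isDiag, mul_comm]
  rintro ⟨x, u⟩ hx ⟨y, v⟩ hy hxy
  simp only [Finset.coe_product, Set.mem_prod, Finset.mem_coe, Finset.mem_sdiff,
    Sym2.mem_toFinset] at hx hy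
  simp only [Sym2.eq_iff] at hxy
  rcases hxy with ⟨rfl, rfl⟩ | ⟨rfl, rfl⟩
  · rfl
  · exact absurd (hcur _ hy.2) hx.1.2

theorem card_toFinset_le_two (e : Sym2 V) : e.toFinset.card ≤ 2 := by
  rw [Sym2.card_toFinset]
  split_ifs <;> omega

variable [Fintype V]

theorem mem_nextPairs {s : ExplorationState V} {e : Sym2 V} :
    e ∈ s.nextPairs ↔ (∃ u ∈ s.old, ∃ x, x ∉ s.verts ∧ e = s(u, x)) ∨
      ((∀ x ∈ e, x ∉ s.verts) ∧ ¬ e.IsDiag) := by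
  simp only [nextPairs, Finset.mem_union, Finset.mem_image, Finset.mem_product,
    Finset.mem_compl, Prod.exists, Finset.mem_filter, Finset.mem_sym2_iff]
  constructor
  · rintro (⟨u, x, ⟨hu, hx⟩, rfl⟩ | h)
    · exact Or.inl ⟨u, hu, x, hx, rfl⟩
    · exact Or.inr h
  · rintro (⟨u, hu, x, hx, rfl⟩ | h)
    · exact Or.inl ⟨u, x, ⟨hu, hx⟩, rfl⟩
    · exact Or.inr h

theorem Valid.advance {s : ExplorationState V} (hs : s.Valid) {e : Sym2 V}
    (he : e ∈ s.nextPairs) : (s.advance e).Valid where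
  cur_not_isDiag := by
    rcases mem_nextPairs.1 he with ⟨u, hu, x, hx, rfl⟩ | h
    · have : u ≠ x := by rintro rfl; exact hx (hs.old_subset hu)
      simpa [ExplorationState.advance] using this
    · exact h.2
  cur_mem := toFinset_subset_iff.1 Finset.subset_union_right
  old_subset := (toFinset_subset_iff.2 hs.cur_mem).trans Finset.subset_union_left
  edges_subset := by
    refine Finset.union_subset
      (hs.edges_subset.trans (Finset.sym2_mono Finset.subset_union_left)) fun t ht => ?_
    obtain ⟨x, hx, -, u, hu, rfl⟩ := mem_newEdges.1 ht
    rw [Finset.mk_mem_sym2_iff]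
    exact ⟨Finset.mem_union_right _ (Sym2.mem_toFinset.2 hx),
      Finset.mem_union_left _ (Finset.mem_sym2_iff.1 hs.cur_mem u hu)⟩

theorem sum_nextPairs_le {s : ExplorationState V} (hs : s.Valid) {p : ℝ} (hp : 0 ≤ p) :
    ∑ e ∈ s.nextPairs, p ^ (s.advance e).edges.card ≤
      p ^ s.edges.card * (s.old.card * (Fintype.card V * p ^ 2) +
        (Fintype.card V * p ^ 2) ^ 2 / 2) := by
  have hnn : ∀ e : Sym2 V, 0 ≤ p ^ (s.advance e).edges.card := fun e => pow_nonneg hp _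
  have hone : ∑ e ∈ (s.old ×ˢ s.vertsᶜ).image (fun q => s(q.1, q.2)),
      p ^ (s.advance e).edges.card ≤
        p ^ s.edges.card * (s.old.card * (Fintype.card V * p ^ 2)) := by
    refine (Finset.sum_image_le_of_nonneg fun _ _ => hnn _).trans ?_
    have hterm : ∀ q ∈ s.old ×ˢ s.vertsᶜ,
        p ^ (s.advance s(q.1, q.2)).edges.card = p ^ s.edges.card * p ^ 2 := by
      rintro ⟨u, x⟩ hq
      simp only [Finset.mem_product, Finset.mem_compl] at hq
      have : (s(u, x)).toFinset \ s.verts = {x} := by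
        ext y
        simp only [Finset.mem_sdiff, Sym2.mem_toFinset, Sym2.mem_iff, Finset.mem_singleton]
        constructor
        · rintro ⟨rfl | rfl, h⟩
          · exact absurd (hs.old_subset hq.1) h
          · rfl
        · rintro rfl
          exact ⟨Or.inr rfl, hq.2⟩
      rw [card_edges_advance hs, this, Finset.card_singleton, pow_add]
    rw [Finset.sum_congr rfl hterm, Finset.sum_const, Finset.card_product, nsmul_eq_mul]
    have hc : ((s.vertsᶜ.card : ℕ) : ℝ) ≤ Fintype.card V := by
      exact_mod_cast Finset.card_le_univ _
    push_cast
    calc (s.old.card : ℝ) * s.vertsᶜ.card * (p ^ s.edges.card * p ^ 2)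
        ≤ s.old.card * Fintype.card V * (p ^ s.edges.card * p ^ 2) := by gcongr
      _ = _ := by ring
  have htwo : ∑ e ∈ s.vertsᶜ.sym2.filter (fun e => ¬ e.IsDiag),
      p ^ (s.advance e).edges.card ≤
        p ^ s.edges.card * ((Fintype.card V * p ^ 2) ^ 2 / 2) := by
    have hterm : ∀ e ∈ s.vertsᶜ.sym2.filter (fun e => ¬ e.IsDiag),
        p ^ (s.advance e).edges.card = p ^ s.edges.card * p ^ 4 := by
      intro e he
      simp only [Finset.mem_filter, Finset.mem_sym2_iff, Finset.mem_compl] at he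
      have : e.toFinset \ s.verts = e.toFinset := by
        rw [Finset.sdiff_eq_self_iff_disjoint, Finset.disjoint_left]
        intro x hx
        exact he.1 x (Sym2.mem_toFinset.1 hx)
      rw [card_edges_advance hs, this, Sym2.card_toFinset_of_not_isDiag _ he.2, pow_add]
    rw [Finset.sum_congr rfl hterm, Finset.sum_const, nsmul_eq_mul]
    have hc : (((s.vertsᶜ.sym2.filter (fun e => ¬ e.IsDiag)).card : ℕ) : ℝ) ≤
        (Fintype.card V : ℝ) ^ 2 / 2 := by
      have h1 : (s.vertsᶜ.sym2.filter (fun e => ¬ e.IsDiag)).card ≤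
          (Fintype.card V).choose 2 := by
        rw [← Sym2.card_subtype_not_diag, Fintype.card_subtype]
        exact Finset.card_le_card fun e he => by simpa using (Finset.mem_filter.1 he).2
      have h2 : (((Fintype.card V).choose 2 : ℕ) : ℝ) ≤ (Fintype.card V : ℝ) ^ 2 / 2 := by
        rw [Nat.cast_choose_two]
        nlinarith [(Nat.cast_nonneg (Fintype.card V) : (0 : ℝ) ≤ _)]
      exact (Nat.cast_le.2 h1).trans h2
    calc _ ≤ (Fintype.card V : ℝ) ^ 2 / 2 * (p ^ s.edges.card * p ^ 4) := by gcongr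
      _ = _ := by ring
  rw [mul_add]
  refine le_trans ?_ (add_le_add hone htwo)
  rw [nextPairs, ← Finset.sum_union_inter]
  exact le_add_of_nonneg_right (Finset.sum_nonneg fun _ _ => hnn _)

theorem mem_explored_succ {s t : ExplorationState V} {l : ℕ} :
    t ∈ s.explored (l + 1) ↔ ∃ r ∈ s.explored l, ∃ e ∈ r.nextPairs, r.advance e = t := by
  simp [explored]

theorem Valid.of_mem_explored {s : ExplorationState V} (hs : s.Valid) {l : ℕ} :
    ∀ {t : ExplorationState V}, t ∈ s.explored l → t.Valid := by
  induction l with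
  | zero =>
    intro t ht
    rw [explored, Finset.mem_singleton] at ht
    exact ht ▸ hs
  | succ l ih =>
    intro t ht
    obtain ⟨r, hr, e, he, rfl⟩ := mem_explored_succ.1 ht
    exact (ih hr).advance he

theorem verts_subset_of_mem_explored {s : ExplorationState V} {l : ℕ} :
    ∀ {t : ExplorationState V}, t ∈ s.explored l → s.verts ⊆ t.verts := by
  induction l with
  | zero =>
    intro t ht
    rw [explored, Finset.mem_singleton] at ht
    exact ht ▸ Finset.Subset.refl _
  | succ l ih =>
    intro t ht
    obtain ⟨r, hr, e, he, rfl⟩ := mem_explored_succ.1 ht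
    exact (ih hr).trans Finset.subset_union_left

theorem card_verts_le_of_mem_explored {s : ExplorationState V} {l : ℕ} :
    ∀ {t : ExplorationState V}, t ∈ s.explored l → t.verts.card ≤ s.verts.card + 2 * l := by
  induction l with
  | zero =>
    intro t ht
    rw [explored, Finset.mem_singleton] at ht
    simp [ht]
  | succ l ih =>
    intro t ht
    obtain ⟨r, hr, e, he, rfl⟩ := mem_explored_succ.1 ht
    have h := (Finset.card_union_le r.verts e.toFinset).trans
      (add_le_add (ih hr) (card_toFinset_le_two e))
    exact h.trans (by omega)

theorem sum_explored_succ_le {s : ExplorationState V} (hs : s.Valid) {p q : ℝ} (hp : 0 ≤ p)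
    (hq : 2 * (Fintype.card V * p ^ 2) + (Fintype.card V * p ^ 2) ^ 2 / 2 ≤ q) (l : ℕ) :
    ∑ t ∈ s.explored (l + 1), p ^ t.edges.card ≤
      p ^ s.edges.card * (s.old.card * (Fintype.card V * p ^ 2) +
        (Fintype.card V * p ^ 2) ^ 2 / 2) * q ^ l := by
  have hstep : ∀ t : ExplorationState V, t.Valid →
      ∑ r ∈ t.nextPairs.image t.advance, p ^ r.edges.card ≤
        p ^ t.edges.card * (t.old.card * (Fintype.card V * p ^ 2) +
          (Fintype.card V * p ^ 2) ^ 2 / 2) := fun t ht =>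
    (Finset.sum_image_le_of_nonneg fun _ _ => pow_nonneg hp _).trans (sum_nextPairs_le ht hp)
  have hq0 : 0 ≤ q := le_trans (by positivity) hq
  induction l with
  | zero =>
    rw [pow_zero, mul_one]
    simpa [explored] using hstep s hs
  | succ l ih =>
    rw [explored]
    refine (Finset.sum_biUnion_le_sum_sum _ _ _ fun _ => pow_nonneg hp _).trans ?_
    rw [pow_succ q l, ← mul_assoc]
    refine le_trans ?_ (mul_le_mul_of_nonneg_right ih hq0)
    rw [Finset.sum_mul]
    refine Finset.sum_le_sum fun t ht => (hstep t (hs.of_mem_explored ht)).trans ?_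
    have hold : (t.old.card : ℝ) ≤ 2 := by
      obtain ⟨r, -, e, -, rfl⟩ := mem_explored_succ.1 ht
      exact_mod_cast card_toFinset_le_two r.cur
    refine mul_le_mul_of_nonneg_left (le_trans ?_ hq) (pow_nonneg hp _)
    gcongr

end ExplorationState

namespace ExplorationState

/-- The initial state of an exploration that starts at the pair `f` inside `W`. -/
def start {V : Type*} (W : Finset V) (F : Finset (Sym2 V)) (f : Sym2 V) : ExplorationState V :=
  ⟨W, f, W, F⟩

theorem valid_start {V : Type*} [DecidableEq V] {W : Finset V} {F : Finset (Sym2 V)} {f : Sym2 V}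
    (hF : F ⊆ W.sym2) (hf : f ∈ W.sym2) (hd : ¬ f.IsDiag) : (start W F f).Valid :=
  ⟨hd, hf, Finset.Subset.refl _, hF⟩

/-- All the known edges of the state are present in `ω`. -/
def Realized {V : Type*} (s : ExplorationState V) (ω : Sym2 V → Bool) : Prop :=
  ∀ t ∈ s.edges, ω t = true

instance {V : Type*} (s : ExplorationState V) (ω : Sym2 V → Bool) : Decidable (s.Realized ω) :=
  Classical.propDecidable _

/-- The states within `L` steps of a pair of distinct vertices of `W`. -/
def exploredWithin {V : Type*} [DecidableEq V] [Fintype V] (W : Finset V)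
    (F : Finset (Sym2 V)) (L : ℕ) : Finset (ExplorationState V) :=
  (W.sym2.filter fun f => ¬ f.IsDiag).biUnion fun f =>
    (Finset.range (L + 1)).biUnion fun l => (start W F f).explored l

/-- The states at exactly `L` steps from a pair of distinct vertices of `W`. -/
def exploredAt {V : Type*} [DecidableEq V] [Fintype V] (W : Finset V)
    (F : Finset (Sym2 V)) (L : ℕ) : Finset (ExplorationState V) :=
  (W.sym2.filter fun f => ¬ f.IsDiag).biUnion fun f => (start W F f).explored L

theorem mem_exploredAt {V : Type*} [DecidableEq V] [Fintype V] {W : Finset V}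
    {F : Finset (Sym2 V)} {L : ℕ} {s : ExplorationState V} :
    s ∈ exploredAt W F L ↔
      ∃ f, (f ∈ W.sym2 ∧ ¬ f.IsDiag) ∧ s ∈ (start W F f).explored L := by
  simp only [exploredAt, Finset.mem_biUnion, Finset.mem_filter]

theorem mem_exploredWithin {V : Type*} [DecidableEq V] [Fintype V] {W : Finset V}
    {F : Finset (Sym2 V)} {L : ℕ} {s : ExplorationState V} :
    s ∈ exploredWithin W F L ↔
      ∃ f, (f ∈ W.sym2 ∧ ¬ f.IsDiag) ∧ ∃ l ≤ L, s ∈ (start W F f).explored l := by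
  simp only [exploredWithin, Finset.mem_biUnion, Finset.mem_filter, Finset.mem_range,
    Nat.lt_succ_iff]

theorem exists_new_vertex {V : Type*} [DecidableEq V] [Fintype V] {s : ExplorationState V}
    (hs : s.Valid) {e : Sym2 V} (he : e ∈ s.nextPairs) :
    ∃ x ∈ e, x ∉ s.verts ∧ ∀ w, s(x, w) ∈ (s.advance e).edges → w ∈ s.cur := by
  obtain ⟨x, hxe, hx⟩ : ∃ x ∈ e, x ∉ s.verts := by
    rcases mem_nextPairs.1 he with ⟨u, -, x, hx, rfl⟩ | h
    · exact ⟨x, by simp, hx⟩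
    · exact ⟨_, e.out_fst_mem, h.1 _ e.out_fst_mem⟩
  refine ⟨x, hxe, hx, fun w hw => ?_⟩
  rcases Finset.mem_union.1 hw with hw | hw
  · exact absurd (Finset.mk_mem_sym2_iff.1 (hs.edges_subset hw)).1 hx
  · obtain ⟨y, -, -, u, hu, h⟩ := mem_newEdges.1 hw
    rcases Sym2.eq_iff.1 h with ⟨rfl, rfl⟩ | ⟨rfl, rfl⟩
    · exact hu
    · exact absurd (Finset.mem_sym2_iff.1 hs.cur_mem _ hu) hx

end ExplorationState

theorem graphOf_adj {n : ℕ} {ω : Sym2 (Fin n) → Bool} {x y : Fin n} :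
    (graphOf ω).Adj x y ↔ x ≠ y ∧ ω s(x, y) = true := by
  simp [graphOf, SimpleGraph.fromRel_adj, Sym2.eq_swap (a := y) (b := x)]

theorem squareGraph_adj {V : Type*} {Γ : SimpleGraph V} {e f : Sym2 V}
    (h : (squareGraph Γ).Adj e f) :
    ¬ e.IsDiag ∧ ¬ f.IsDiag ∧ ∀ u ∈ e, ∀ v ∈ f, Γ.Adj u v := by
  rw [squareGraph, SimpleGraph.fromRel_adj] at h
  rcases h.2 with ⟨a, b, c, d, rfl, rfl, hac, hbd, -, -, hab, hbc, hcd, hda⟩ |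
    ⟨a, b, c, d, rfl, rfl, hac, hbd, -, -, hab, hbc, hcd, hda⟩ <;>
  · refine ⟨by simpa, by simpa, fun u hu v hv => ?_⟩
    rcases Sym2.mem_iff.1 hu with rfl | rfl <;> rcases Sym2.mem_iff.1 hv with rfl | rfl <;>
      first | assumption | (apply SimpleGraph.Adj.symm; assumption)

theorem ExplorationState.advance_of_squareGraph_adj {n : ℕ} {ω : Sym2 (Fin n) → Bool}
    {s : ExplorationState (Fin n)} (hω : s.Realized ω) {e : Sym2 (Fin n)}
    (h : (squareGraph (graphOf ω)).Adj s.cur e) (hnew : e ∉ s.verts.sym2)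
    (hold : ∀ w ∈ e, w ∈ s.verts → w ∈ s.old) :
    e ∈ s.nextPairs ∧ (s.advance e).Realized ω := by
  obtain ⟨-, hd, hadj⟩ := squareGraph_adj h
  constructor
  · rw [mem_nextPairs]
    by_cases hall : ∀ x ∈ e, x ∉ s.verts
    · exact Or.inr ⟨hall, hd⟩
    · push Not at hall
      obtain ⟨u, hu, hus⟩ := hall
      obtain ⟨x, rfl⟩ := hu
      refine Or.inl ⟨u, hold u (Sym2.mem_mk_left _ _) hus, x, fun hx => hnew ?_, rfl⟩
      exact Finset.mk_mem_sym2_iff.2 ⟨hus, hx⟩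
  · intro t ht
    rcases Finset.mem_union.1 ht with ht | ht
    · exact hω t ht
    · obtain ⟨x, hx, -, u, hu, rfl⟩ := mem_newEdges.1 ht
      exact (graphOf_adj.1 (hadj u hu x hx).symm).2

open ExplorationState in
/-- If no unexpected edge appears within `L` steps and no exploration path has length `L`, then
the exploration from `W` finds the whole square-component. -/
theorem squareComponent_subset {n : ℕ} {ω : Sym2 (Fin n) → Bool} {W : Finset (Fin n)}
    {F : Finset (Sym2 (Fin n))} {L : ℕ} {e₀ : Sym2 (Fin n)} (hL : 1 ≤ L) (he₀ : e₀ ∈ W.sym2)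
    (hF : F ⊆ W.sym2) (hω : ∀ t ∈ F, ω t = true)
    (hedge : ∀ s ∈ exploredWithin W F L, s.Realized ω →
      ∀ t ∈ s.verts.sym2, ω t = true → t ∈ s.edges)
    (hlong : ∀ s ∈ exploredAt W F L, ¬ s.Realized ω) :
    squareComponent (graphOf ω) e₀ ⊆
      ↑(W.sym2 ∪ ((exploredWithin W F L).filter fun s => s.Realized ω).image cur) := by
  classical
  set R : Set (Sym2 (Fin n)) :=
    ↑(W.sym2 ∪ ((exploredWithin W F L).filter fun s => s.Realized ω).image cur) with hR
  have hmem : ∀ e, e ∈ R ↔ e ∈ W.sym2 ∨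
      ∃ s ∈ exploredWithin W F L, s.Realized ω ∧ s.cur = e := by
    intro e
    simp only [hR, Finset.mem_coe, Finset.mem_union, Finset.mem_image, Finset.mem_filter,
      and_assoc]
  have hclosed : ∀ e f, e ∈ R → (squareGraph (graphOf ω)).Adj e f → f ∈ R := by
    intro e f he hef
    obtain ⟨hed, hfd, hadj⟩ := squareGraph_adj hef
    by_cases heW : e ∈ W.sym2
    · by_cases hfW : f ∈ W.sym2
      · exact (hmem f).2 (Or.inl hfW)
      · have hreal : (start W F e).Realized ω := hω
        obtain ⟨hnext, hadv⟩ := advance_of_squareGraph_adj hreal hef hfW fun w _ hw => hw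
        refine (hmem f).2 (Or.inr ⟨_, mem_exploredWithin.2 ⟨e, ⟨heW, hed⟩, 1, hL, ?_⟩, hadv, rfl⟩)
        exact mem_explored_succ.2 ⟨_, Finset.mem_singleton_self _, f, hnext, rfl⟩
    · obtain ⟨s, hs, hreal, rfl⟩ := ((hmem e).1 he).resolve_left heW
      obtain ⟨g, hg, l, hl, hsl⟩ := mem_exploredWithin.1 hs
      have hlL : l ≠ L := by
        rintro rfl
        exact hlong s (mem_exploredAt.2 ⟨g, hg, hsl⟩) hreal
      obtain _ | l := l
      · rw [explored, Finset.mem_singleton] at hsl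
        exact absurd (hsl ▸ hg.1) heW
      obtain ⟨r, hr, e, hnext, rfl⟩ := mem_explored_succ.1 hsl
      have hstart := valid_start hF hg.1 hg.2
      have hrv := hstart.of_mem_explored hr
      have hrR : r.cur ∈ R := (hmem _).2 (Or.inr ⟨r, mem_exploredWithin.2
        ⟨g, hg, l, by omega, hr⟩, fun t ht => hreal t (Finset.mem_union_left _ ht), rfl⟩)
      obtain ⟨x, hxe, -, hx⟩ := exists_new_vertex hrv hnext
      have hsv := hrv.advance hnext
      have hold : ∀ w ∈ f, w ∈ (r.advance e).verts → w ∈ r.cur := by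
        intro w hw hwv
        refine hx w (hedge _ hs hreal _ ?_ (graphOf_adj.1 (hadj x hxe w hw)).2)
        exact Finset.mk_mem_sym2_iff.2 ⟨Finset.mem_sym2_iff.1 hsv.cur_mem x hxe, hwv⟩
      by_cases hfv : f ∈ (r.advance e).verts.sym2
      · have hfr : f = r.cur := by
          rw [Finset.mem_sym2_iff] at hfv
          revert hfd hold hfv
          refine f.ind fun a b => ?_
          intro hab hold hfv
          refine ((Sym2.mem_and_mem_iff (by simpa using hab)).1 ⟨?_, ?_⟩).symm
          · exact hold a (Sym2.mem_mk_left _ _) (hfv a (Sym2.mem_mk_left _ _))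
          · exact hold b (Sym2.mem_mk_right _ _) (hfv b (Sym2.mem_mk_right _ _))
        exact hfr ▸ hrR
      · obtain ⟨hnext', hadv⟩ := advance_of_squareGraph_adj hreal hef hfv fun w hw hwv =>
          Sym2.mem_toFinset.2 (hold w hw hwv)
        refine (hmem f).2 (Or.inr ⟨_, mem_exploredWithin.2
          ⟨g, hg, l + 2, by omega, ?_⟩, hadv, rfl⟩)
        exact mem_explored_succ.2 ⟨_, hsl, f, hnext', rfl⟩
  rintro e ⟨walk⟩
  have hwalk : ∀ a b, (squareGraph (graphOf ω)).Walk a b → a ∈ R → b ∈ R := by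
    intro a b q
    induction q with
    | nil => exact id
    | cons hadj _ ih => exact fun ha => ih (hclosed _ _ ha hadj)
  exact hwalk _ _ walk ((hmem _).2 (Or.inl he₀))

namespace ExplorationState

theorem card_sym2_le_sq {V : Type*} {W : Finset V} {M : ℕ} (hW : W.card ≤ M) : W.sym2.card ≤ M ^ 2 := by
  rw [Finset.card_sym2, Nat.choose_two_right, Nat.add_sub_cancel]
  refine Nat.div_le_of_le_mul ?_
  nlinarith [Nat.mul_le_mul hW hW, Nat.le_mul_self W.card]

theorem start_step_le {V : Type*} [Fintype V] {W : Finset V} {p : ℝ} {M : ℕ}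
    (hM : 1 ≤ M) (hW : W.card ≤ M) (hx : Fintype.card V * p ^ 2 ≤ 1 / 2) :
    (W.card : ℝ) * (Fintype.card V * p ^ 2) + (Fintype.card V * p ^ 2) ^ 2 / 2 ≤ M := by
  have h1 : (1 : ℝ) ≤ M := by exact_mod_cast hM
  have h2 : (W.card : ℝ) ≤ M := by exact_mod_cast hW
  have h0 : 0 ≤ Fintype.card V * p ^ 2 := by positivity
  nlinarith [(Nat.cast_nonneg W.card : (0 : ℝ) ≤ _)]

variable {V : Type*} [DecidableEq V] [Fintype V] {W : Finset V} {F : Finset (Sym2 V)} {p : ℝ}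
  {M : ℕ}

theorem sum_exploredAt_le (hM : 1 ≤ M) (hW : W.card ≤ M) (hF : F ⊆ W.sym2) (hp : 0 ≤ p)
    (hx : Fintype.card V * p ^ 2 ≤ 1 / 2) {q : ℝ}
    (hq : 2 * (Fintype.card V * p ^ 2) + (Fintype.card V * p ^ 2) ^ 2 / 2 ≤ q) (l : ℕ) :
    ∑ s ∈ exploredAt W F (l + 1), p ^ s.edges.card ≤ p ^ F.card * ((M : ℝ) ^ 3 * q ^ l) := by
  have hq0 : 0 ≤ q := le_trans (by positivity) hq
  refine (Finset.sum_biUnion_le_sum_sum _ _ _ fun _ => pow_nonneg hp _).trans ?_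
  have hterm : ∀ f ∈ W.sym2.filter (fun f => ¬ f.IsDiag),
      ∑ s ∈ (start W F f).explored (l + 1), p ^ s.edges.card ≤ p ^ F.card * M * q ^ l := by
    intro f hf
    rw [Finset.mem_filter] at hf
    refine (sum_explored_succ_le (valid_start hF hf.1 hf.2) hp hq l).trans ?_
    have := start_step_le hM hW hx
    simp only [start]
    gcongr
  refine (Finset.sum_le_card_nsmul _ _ _ hterm).trans ?_
  have hc : (((W.sym2.filter (fun f => ¬ f.IsDiag)).card : ℕ) : ℝ) ≤ (M : ℝ) ^ 2 := by
    exact_mod_cast (Finset.card_filter_le _ _).trans (card_sym2_le_sq hW)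
  rw [nsmul_eq_mul]
  calc _ ≤ (M : ℝ) ^ 2 * (p ^ F.card * M * q ^ l) := by gcongr
    _ = _ := by ring

theorem sum_exploredWithin_le {L : ℕ} (hL : L + 1 ≤ M) (hW : W.card ≤ M) (hF : F ⊆ W.sym2)
    (hp : 0 ≤ p) (hx : Fintype.card V * p ^ 2 ≤ 1 / 2) {q : ℝ}
    (hq : 2 * (Fintype.card V * p ^ 2) + (Fintype.card V * p ^ 2) ^ 2 / 2 ≤ q) (hq1 : q ≤ 1) :
    ∑ s ∈ exploredWithin W F L, p ^ s.edges.card ≤ p ^ F.card * (M : ℝ) ^ 4 := by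
  have hq0 : 0 ≤ q := le_trans (by positivity) hq
  have hM : 1 ≤ M := by omega
  have hM' : (1 : ℝ) ≤ M := by exact_mod_cast hM
  refine (Finset.sum_biUnion_le_sum_sum _ _ _ fun _ => pow_nonneg hp _).trans ?_
  have hterm : ∀ f ∈ W.sym2.filter (fun f => ¬ f.IsDiag), ∀ l ∈ Finset.range (L + 1),
      ∑ s ∈ (start W F f).explored l, p ^ s.edges.card ≤ p ^ F.card * M := by
    intro f hf l _
    rw [Finset.mem_filter] at hf
    obtain _ | l := l
    · simpa [explored, start] using le_mul_of_one_le_right (pow_nonneg hp F.card) hM'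
    · refine (sum_explored_succ_le (valid_start hF hf.1 hf.2) hp hq l).trans ?_
      have := start_step_le hM hW hx
      refine (mul_le_of_le_one_right ?_ (pow_le_one₀ hq0 hq1)).trans ?_
      · simp only [start]; positivity
      · simp only [start]; gcongr
  have hsum : ∀ f ∈ W.sym2.filter (fun f => ¬ f.IsDiag),
      ∑ s ∈ (Finset.range (L + 1)).biUnion (fun l => (start W F f).explored l),
        p ^ s.edges.card ≤ M * (p ^ F.card * M) := by
    intro f hf
    refine (Finset.sum_biUnion_le_sum_sum _ _ _ fun _ => pow_nonneg hp _).trans ?_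
    refine (Finset.sum_le_card_nsmul _ _ _ (hterm f hf)).trans ?_
    have hc : ((Finset.range (L + 1)).card : ℝ) ≤ M := by
      rw [Finset.card_range]; exact_mod_cast hL
    rw [nsmul_eq_mul]
    gcongr
  refine (Finset.sum_le_card_nsmul _ _ _ hsum).trans ?_
  have hc : (((W.sym2.filter (fun f => ¬ f.IsDiag)).card : ℕ) : ℝ) ≤ (M : ℝ) ^ 2 := by
    exact_mod_cast (Finset.card_filter_le _ _).trans (card_sym2_le_sq hW)
  rw [nsmul_eq_mul]
  calc _ ≤ (M : ℝ) ^ 2 * (M * (p ^ F.card * M)) := by gcongr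
    _ = _ := by ring

end ExplorationState

theorem isProbabilityMeasure_bernoulliBool {p : ℝ} (hp0 : 0 ≤ p) (hp1 : p ≤ 1) :
    IsProbabilityMeasure (bernoulliBool p) :=
  ⟨by simp [bernoulliBool, ← ENNReal.ofReal_add hp0 (sub_nonneg.2 hp1)]⟩

theorem isProbabilityMeasure_erMeasure (n : ℕ) {p : ℝ} (hp0 : 0 ≤ p) (hp1 : p ≤ 1) :
    IsProbabilityMeasure (erMeasure n p) := by
  have := isProbabilityMeasure_bernoulliBool hp0 hp1
  unfold erMeasure
  infer_instance

/-- The event that all the pairs in `F` are present. -/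
def allPresent {n : ℕ} (F : Finset (Sym2 (Fin n))) : Set (Sym2 (Fin n) → Bool) :=
  {ω | ∀ t ∈ F, ω t = true}

theorem erMeasure_real_allPresent {n : ℕ} {p : ℝ} (hp0 : 0 ≤ p) (hp1 : p ≤ 1)
    (F : Finset (Sym2 (Fin n))) : (erMeasure n p).real (allPresent F) = p ^ F.card := by
  have := isProbabilityMeasure_bernoulliBool hp0 hp1
  have hset : allPresent F = Set.univ.pi fun t => if t ∈ F then {true} else Set.univ := by
    ext ω
    simp only [allPresent, Set.mem_ofPred_eq, Set.mem_pi, Set.mem_univ, true_imp_iff]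
    refine forall_congr' fun t => ?_
    split_ifs with h <;> simp [h]
  have hone : bernoulliBool p {true} = ENNReal.ofReal p := by
    simp [bernoulliBool]
  rw [measureReal_def, hset, erMeasure, Measure.pi_pi]
  have : ∀ t : Sym2 (Fin n), bernoulliBool p (if t ∈ F then {true} else Set.univ) =
      if t ∈ F then ENNReal.ofReal p else 1 := by
    intro t
    split_ifs
    · exact hone
    · exact measure_univ
  simp only [this, Finset.prod_ite_mem, Finset.univ_inter, Finset.prod_const,
    ENNReal.toReal_pow, ENNReal.toReal_ofReal hp0]

theorem mul_measureReal_le_sum {Ω ι : Type*} [Finite Ω] [MeasurableSpace Ω]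
    [MeasurableSingletonClass Ω] (μ : Measure Ω) [IsFiniteMeasure μ] (I : Finset ι)
    (A : ι → Set Ω) [∀ ω, DecidablePred fun i => ω ∈ A i] (D : Set Ω) (S : ℕ) :
    S * μ.real {ω | ω ∈ D ∧ S ≤ (I.filter fun i => ω ∈ A i).card} ≤
      ∑ i ∈ I, μ.real (A i ∩ D) := by
  classical
  have hmeas : ∀ s : Set Ω, MeasurableSet s := fun s => s.toFinite.measurableSet
  have hind : ∀ s : Set Ω, μ.real s = ∫ ω, s.indicator 1 ω ∂μ := fun s =>
    (integral_indicator_one (hmeas s)).symm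
  simp only [hind]
  rw [← integral_const_mul, ← integral_finsetSum _ fun _ _ => Integrable.of_finite]
  refine integral_mono Integrable.of_finite Integrable.of_finite fun ω => ?_
  by_cases hω : ω ∈ {ω | ω ∈ D ∧ S ≤ (I.filter fun i => ω ∈ A i).card}
  · have : ∑ i ∈ I, (A i ∩ D).indicator (1 : Ω → ℝ) ω = (I.filter fun i => ω ∈ A i).card := by
      rw [Finset.card_filter, Nat.cast_sum]
      refine Finset.sum_congr rfl fun i _ => ?_
      by_cases h : ω ∈ A i <;> simp [Set.indicator, h, hω.1]
    simp only [this, Set.indicator_of_mem hω, Pi.one_apply, mul_one]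
    exact_mod_cast hω.2
  · simp only [Set.indicator_of_notMem hω, mul_zero]
    exact Finset.sum_nonneg fun i _ => Set.indicator_nonneg (fun _ _ => zero_le_one) _

/-- The event that the square-component of `e` has more than `T` pairs. -/
def largeComponent {n : ℕ} (e : Sym2 (Fin n)) (T : ℕ) : Set (Sym2 (Fin n) → Bool) :=
  {ω | T < (squareComponent (graphOf ω) e).ncard}

open ExplorationState

theorem allPresent_inter_largeComponent_subset {n : ℕ} {W : Finset (Fin n)}
    {F : Finset (Sym2 (Fin n))} {L M S : ℕ} {e : Sym2 (Fin n)} (hL : 1 ≤ L) (he : e ∈ W.sym2)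
    (hF : F ⊆ W.sym2) (hW : W.card ≤ M) :
    allPresent F ∩ largeComponent e (M ^ 2 + S) ⊆
      ((⋃ s ∈ exploredWithin W F L, ⋃ t ∈ s.verts.sym2 \ s.edges,
          allPresent (insert t s.edges) ∩ largeComponent e (M ^ 2 + S)) ∪
        ⋃ s ∈ exploredAt W F L, allPresent s.edges ∩ largeComponent e (M ^ 2 + S)) ∪
      {ω | ω ∈ largeComponent e (M ^ 2 + S) ∧
        S ≤ ((exploredWithin W F L).filter fun s => s.Realized ω).card} := by
  classical
  rintro ω ⟨hω, hD⟩
  by_cases hedge : ∀ s ∈ exploredWithin W F L, s.Realized ω →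
      ∀ t ∈ s.verts.sym2, ω t = true → t ∈ s.edges
  · by_cases hlong : ∀ s ∈ exploredAt W F L, ¬ s.Realized ω
    · refine Or.inr ⟨hD, ?_⟩
      have hsub := squareComponent_subset hL he hF hω hedge hlong
      have h1 := Set.ncard_le_ncard hsub (Finset.finite_toSet _)
      rw [Set.ncard_coe_finset] at h1
      have h2 := h1.trans (Finset.card_union_le _ _)
      have h3 := card_sym2_le_sq hW
      have h4 := Finset.card_image_le (s := (exploredWithin W F L).filter fun s => s.Realized ω)
        (f := cur)
      have h5 : M ^ 2 + S < (squareComponent (graphOf ω) e).ncard := hD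
      omega
    · push Not at hlong
      obtain ⟨s, hs, hreal⟩ := hlong
      exact Or.inl (Or.inr (Set.mem_iUnion₂.2 ⟨s, hs, hreal, hD⟩))
  · push Not at hedge
    obtain ⟨s, hs, hreal, t, ht, hωt, hts⟩ := hedge
    refine Or.inl (Or.inl (Set.mem_iUnion₂.2 ⟨s, hs, Set.mem_iUnion₂.2
      ⟨t, Finset.mem_sdiff.2 ⟨ht, hts⟩, fun r hr => ?_, hD⟩⟩))
    rcases Finset.mem_insert.1 hr with rfl | hr
    · exact hωt
    · exact hreal r hr

theorem card_verts_add_le {n : ℕ} {W : Finset (Fin n)} {F : Finset (Sym2 (Fin n))} {L : ℕ}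
    {s : ExplorationState (Fin n)} (hs : s ∈ exploredWithin W F L) :
    s.verts.card ≤ W.card + 2 * L := by
  obtain ⟨f, -, l, hl, hsl⟩ := mem_exploredWithin.1 hs
  have := card_verts_le_of_mem_explored hsl
  simp only [start] at this
  omega

theorem exploredAt_subset_exploredWithin {n : ℕ} (W : Finset (Fin n))
    (F : Finset (Sym2 (Fin n))) (L : ℕ) : exploredAt W F L ⊆ exploredWithin W F L := by
  intro s hs
  obtain ⟨f, hf, hsl⟩ := mem_exploredAt.1 hs
  exact mem_exploredWithin.2 ⟨f, hf, L, le_rfl, hsl⟩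

/-- In the presence of the edges `F`, a large square-component forces `g` exceptional or `j`
regular extensions of the explored set `W`. -/
theorem measureReal_allPresent_inter_le {n : ℕ} {p q G R : ℝ} {L M S : ℕ} (hp0 : 0 ≤ p)
    (hp1 : p ≤ 1) (hx : n * p ^ 2 ≤ 1 / 2) (hq : 2 * (n * p ^ 2) + (n * p ^ 2) ^ 2 / 2 ≤ q)
    (hq1 : q ≤ 1) (hL : L + 2 ≤ M) (hS : 0 < S)
    (hG : (M : ℝ) ^ 6 * p + (M : ℝ) ^ 3 * q ^ L ≤ G) (hG1 : G ≤ 1 / 2)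
    (hR : (M : ℝ) ^ 4 / S ≤ R) (hR1 : R ≤ 1 / 2) (e : Sym2 (Fin n)) (k : ℕ) :
    ∀ (j g : ℕ), j + g = k → ∀ (W : Finset (Fin n)) (F : Finset (Sym2 (Fin n))), e ∈ W.sym2 →
      F ⊆ W.sym2 → W.card + 2 * (L + 1) * k ≤ M →
      (erMeasure n p).real (allPresent F ∩ largeComponent e (M ^ 2 + S)) ≤
        p ^ F.card * ((2 * G) ^ g + (2 * R) ^ j) := by
  have := isProbabilityMeasure_erMeasure n hp0 hp1
  have hq0 : 0 ≤ q := le_trans (by positivity) hq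
  have hG0 : 0 ≤ G := le_trans (by positivity) hG
  have hR0 : 0 ≤ R := le_trans (by positivity) hR
  set μ := (erMeasure n p).real with hμ
  set D := largeComponent e (M ^ 2 + S) with hD
  induction k with
  | zero =>
    intro j g hjg W F _ _ _
    obtain ⟨rfl, rfl⟩ : j = 0 ∧ g = 0 := by omega
    refine (measureReal_mono Set.inter_subset_left).trans ?_
    rw [erMeasure_real_allPresent hp0 hp1]
    nlinarith [pow_nonneg hp0 F.card]
  | succ k ih =>
    intro j g hjg W F he hF hW
    have htriv : μ (allPresent F ∩ D) ≤ p ^ F.card * 1 := by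
      refine (measureReal_mono Set.inter_subset_left).trans ?_
      rw [erMeasure_real_allPresent hp0 hp1, mul_one]
    obtain _ | j := j
    · refine htriv.trans (mul_le_mul_of_nonneg_left ?_ (pow_nonneg hp0 _))
      rw [pow_zero]
      exact le_add_of_nonneg_left (by positivity)
    obtain _ | g := g
    · refine htriv.trans (mul_le_mul_of_nonneg_left ?_ (pow_nonneg hp0 _))
      rw [pow_zero]
      exact le_add_of_nonneg_right (by positivity)
    have hWM : W.card ≤ M := by omega
    have hcard : 2 * (L + 1) * (k + 1) = 2 * (L + 1) * k + 2 * (L + 1) := by ring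
    have hx' : (Fintype.card (Fin n) : ℝ) * p ^ 2 ≤ 1 / 2 := by simpa using hx
    have hq' : 2 * ((Fintype.card (Fin n) : ℝ) * p ^ 2) +
        ((Fintype.card (Fin n) : ℝ) * p ^ 2) ^ 2 / 2 ≤ q := by simpa using hq
    have hstate : ∀ s ∈ exploredWithin W F (L + 1), e ∈ s.verts.sym2 ∧ s.edges ⊆ s.verts.sym2 ∧
        s.verts.card + 2 * (L + 1) * k ≤ M := by
      intro s hs
      have hc := card_verts_add_le hs
      obtain ⟨f, hf, l, hl, hsl⟩ := mem_exploredWithin.1 hs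
      refine ⟨Finset.sym2_mono (verts_subset_of_mem_explored hsl) he,
        ((valid_start hF hf.1 hf.2).of_mem_explored hsl).edges_subset, by omega⟩
    set bG : ℝ := (2 * G) ^ g + (2 * R) ^ (j + 1) with hbG
    set bR : ℝ := (2 * G) ^ (g + 1) + (2 * R) ^ j with hbR
    have hbG0 : 0 ≤ bG := by positivity
    have hbR0 : 0 ≤ bR := by positivity
    have hwithin := sum_exploredWithin_le (L := L + 1) hL hWM hF hp0 hx' hq' hq1
    have hat := sum_exploredAt_le (by omega) hWM hF hp0 hx' hq' L
    have hedge : μ (⋃ s ∈ exploredWithin W F (L + 1), ⋃ t ∈ s.verts.sym2 \ s.edges,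
        allPresent (insert t s.edges) ∩ D) ≤ p ^ F.card * ((M : ℝ) ^ 6 * p) * bG := by
      refine (measureReal_biUnion_finset_le _ _).trans ?_
      have hterm : ∀ s ∈ exploredWithin W F (L + 1),
          μ (⋃ t ∈ s.verts.sym2 \ s.edges, allPresent (insert t s.edges) ∩ D) ≤
            p ^ s.edges.card * ((M : ℝ) ^ 2 * p * bG) := by
        intro s hs
        obtain ⟨h1, h2, h3⟩ := hstate s hs
        refine (measureReal_biUnion_finset_le _ _).trans ?_
        have hin : ∀ t ∈ s.verts.sym2 \ s.edges,
            μ (allPresent (insert t s.edges) ∩ D) ≤ p ^ s.edges.card * p * bG := by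
          intro t ht
          rw [Finset.mem_sdiff] at ht
          refine (ih (j + 1) g (by omega) s.verts _ h1 (Finset.insert_subset ht.1 h2) h3).trans_eq ?_
          rw [Finset.card_insert_of_notMem ht.2, pow_succ]
        refine (Finset.sum_le_card_nsmul _ _ _ hin).trans ?_
        have hc : (((s.verts.sym2 \ s.edges).card : ℕ) : ℝ) ≤ (M : ℝ) ^ 2 := by
          exact_mod_cast (Finset.card_le_card Finset.sdiff_subset).trans
            (card_sym2_le_sq (Nat.le_of_add_right_le h3))
        rw [nsmul_eq_mul]
        calc _ ≤ (M : ℝ) ^ 2 * (p ^ s.edges.card * p * bG) := by gcongr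
          _ = _ := by ring
      refine (Finset.sum_le_sum hterm).trans ?_
      rw [← Finset.sum_mul]
      calc _ ≤ p ^ F.card * (M : ℝ) ^ 4 * ((M : ℝ) ^ 2 * p * bG) := by gcongr
        _ = _ := by ring
    have hlong : μ (⋃ s ∈ exploredAt W F (L + 1), allPresent s.edges ∩ D) ≤
        p ^ F.card * ((M : ℝ) ^ 3 * q ^ L) * bG := by
      refine (measureReal_biUnion_finset_le _ _).trans ?_
      refine (Finset.sum_le_sum fun s hs => ?_).trans
        ((Finset.sum_mul _ _ _).symm.le.trans (mul_le_mul_of_nonneg_right hat hbG0))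
      obtain ⟨h1, h2, h3⟩ := hstate s (exploredAt_subset_exploredWithin _ _ _ hs)
      exact ih (j + 1) g (by omega) s.verts _ h1 h2 h3
    have hreg : μ {ω | ω ∈ D ∧
        S ≤ ((exploredWithin W F (L + 1)).filter fun s => s.Realized ω).card} ≤
          p ^ F.card * R * bR := by
      have hS' : (0 : ℝ) < S := by exact_mod_cast hS
      have hmarkov := mul_measureReal_le_sum (erMeasure n p) (exploredWithin W F (L + 1))
        (fun s => {ω | s.Realized ω}) D S
      have hsum : ∑ s ∈ exploredWithin W F (L + 1), μ ({ω | s.Realized ω} ∩ D) ≤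
          p ^ F.card * (M : ℝ) ^ 4 * bR := by
        refine (Finset.sum_le_sum fun s hs => ?_).trans
          ((Finset.sum_mul _ _ _).symm.le.trans (mul_le_mul_of_nonneg_right hwithin hbR0))
        obtain ⟨h1, h2, h3⟩ := hstate s hs
        exact ih j (g + 1) (by omega) s.verts _ h1 h2 h3
      have hle := hmarkov.trans hsum
      rw [mul_comm, ← le_div_iff₀ hS'] at hle
      refine hle.trans ?_
      calc p ^ F.card * (M : ℝ) ^ 4 * bR / S = p ^ F.card * ((M : ℝ) ^ 4 / S) * bR := by ring
        _ ≤ _ := by gcongr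
    refine (measureReal_mono
      (allPresent_inter_largeComponent_subset (L := L + 1) (by omega) he hF hWM)).trans ?_
    refine (measureReal_union_le _ _).trans ?_
    refine (add_le_add ((measureReal_union_le _ _).trans (add_le_add hedge hlong)) hreg).trans ?_
    have hfin : G * bG + R * bR ≤ (2 * G) ^ (g + 1) + (2 * R) ^ (j + 1) := by
      have e1 : G * bG + R * bR = (1 / 2 + R) * (2 * G) ^ (g + 1) +
          (1 / 2 + G) * (2 * R) ^ (j + 1) := by
        rw [hbG, hbR]; ring
      have hg0 : 0 ≤ (2 * G) ^ (g + 1) := by positivity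
      have hj0 : 0 ≤ (2 * R) ^ (j + 1) := by positivity
      rw [e1]
      nlinarith
    calc _ = p ^ F.card * (((M : ℝ) ^ 6 * p + (M : ℝ) ^ 3 * q ^ L) * bG + R * bR) := by ring
      _ ≤ p ^ F.card * (G * bG + R * bR) := by gcongr
      _ ≤ _ := by gcongr

theorem ncard_suppOf_le {n : ℕ} (C : Set (Sym2 (Fin n))) : (suppOf C).ncard ≤ 2 * C.ncard := by
  classical
  have hC := C.toFinite
  have h : suppOf C = ↑(hC.toFinset.biUnion Sym2.toFinset) := by
    ext v
    simp [suppOf]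
  rw [h, Set.ncard_coe_finset, Set.ncard_eq_toFinset_card C hC, mul_comm]
  exact Finset.card_biUnion_le_card_mul _ _ _ fun e _ => ExplorationState.card_toFinset_le_two e

theorem tendsto_log_pow_div_sqrt (a : ℕ) :
    Tendsto (fun n : ℕ => Real.log n ^ a / Real.sqrt n) atTop (nhds 0) := by
  have hsqrt : Tendsto (fun n : ℕ => Real.sqrt n) atTop atTop :=
    Real.tendsto_sqrt_atTop.comp tendsto_natCast_atTop_atTop
  have h := (((Real.isLittleO_pow_log_id_atTop (n := a)).tendsto_div_nhds_zero).comp hsqrt).const_mul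
    ((2 : ℝ) ^ a)
  rw [mul_zero] at h
  refine h.congr fun n => ?_
  have hlog : Real.log n = 2 * Real.log (Real.sqrt n) := by
    rw [Real.log_sqrt (Nat.cast_nonneg n)]; ring
  simp only [Function.comp_apply, id]
  rw [hlog, mul_pow]
  ring

theorem two_mul_sq_add_lt_one {lam : ℝ} (h0 : 0 ≤ lam) (h : lam < lambdaC) :
    2 * lam ^ 2 + (lam ^ 2) ^ 2 / 2 < 1 := by
  have h6 : (0 : ℝ) ≤ Real.sqrt 6 - 2 := by
    rw [sub_nonneg]; exact Real.le_sqrt_of_sq_le (by norm_num)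
  have h1 : lam ^ 2 < Real.sqrt 6 - 2 := (Real.lt_sqrt h0).1 h
  have h2 : Real.sqrt 6 ^ 2 = 6 := Real.sq_sqrt (by norm_num)
  nlinarith [sq_nonneg lam]

theorem measureReal_iUnion_largeComponent_le {n : ℕ} {p q G : ℝ} {L j M : ℕ} (hp0 : 0 ≤ p)
    (hp1 : p ≤ 1) (hx : n * p ^ 2 ≤ 1 / 2) (hq : 2 * (n * p ^ 2) + (n * p ^ 2) ^ 2 / 2 ≤ q)
    (hq1 : q ≤ 1) (hM : M = 2 + 2 * (L + 1) * (j + 5))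
    (hG : (M : ℝ) ^ 6 * p + (M : ℝ) ^ 3 * q ^ L ≤ G) (hG1 : G ≤ 1 / 2) :
    (erMeasure n p).real (⋃ e : Sym2 (Fin n), largeComponent e (M ^ 2 + 6 * M ^ 4)) ≤
      (n : ℝ) ^ 2 * ((2 * G) ^ 5 + (1 / 3) ^ j) := by
  have := isProbabilityMeasure_erMeasure n hp0 hp1
  have hG0 : 0 ≤ G := le_trans (by have := le_trans (by positivity) hq; positivity) hG
  have hMpos : 0 < M := by omega
  have hLM : L + 2 ≤ M := by rw [hM]; nlinarith [Nat.zero_le (L * j)]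
  have hMne : (M : ℝ) ^ 4 ≠ 0 := by positivity
  have hR : (M : ℝ) ^ 4 / ((6 * M ^ 4 : ℕ) : ℝ) ≤ 1 / 6 := by
    push_cast
    rw [div_le_div_iff₀ (by positivity) (by norm_num)]
    linarith
  have hone : ∀ e ∈ (Finset.univ : Finset (Sym2 (Fin n))),
      (erMeasure n p).real (largeComponent e (M ^ 2 + 6 * M ^ 4)) ≤
        (2 * G) ^ 5 + (1 / 3) ^ j := by
    intro e _
    have h := measureReal_allPresent_inter_le hp0 hp1 hx hq hq1 hLM
      (S := 6 * M ^ 4) (by positivity) hG hG1 hR (by norm_num) e (j + 5) j 5 rfl e.toFinset ∅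
      (ExplorationState.toFinset_subset_iff.1 (Finset.Subset.refl _)) (Finset.empty_subset _)
      (hM ▸ Nat.add_le_add_right (ExplorationState.card_toFinset_le_two e) _)
    have huniv : allPresent (∅ : Finset (Sym2 (Fin n))) = Set.univ := by
      simp [allPresent]
    rw [huniv, Set.univ_inter, Finset.card_empty, pow_zero, one_mul] at h
    refine h.trans_eq ?_
    norm_num
  have hcard : ((Finset.univ : Finset (Sym2 (Fin n))).card : ℝ) ≤ (n : ℝ) ^ 2 := by
    have h := ExplorationState.card_sym2_le_sq
      (W := (Finset.univ : Finset (Fin n))) (M := n) (by simp)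
    rw [Finset.sym2_univ] at h
    exact_mod_cast h
  have h := measureReal_biUnion_finset_le (μ := erMeasure n p) (Finset.univ : Finset (Sym2 (Fin n)))
    fun e => largeComponent e (M ^ 2 + 6 * M ^ 4)
  simp only [Finset.mem_univ, Set.iUnion_true] at h
  refine h.trans ((Finset.sum_le_card_nsmul _ _ _ hone).trans ?_)
  rw [nsmul_eq_mul]
  gcongr

theorem pow_ceil_mul_log_le {n : ℕ} (hn : 1 ≤ n) {q A : ℝ} (hq0 : 0 < q) (hlogq : Real.log q < 0)
    (hAq : A * Real.log q = -(1 / 2)) : q ^ ⌈A * Real.log n⌉₊ ≤ 1 / Real.sqrt n := by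
  have hnpos : (0 : ℝ) < n := by exact_mod_cast hn
  have h1 : q ^ ⌈A * Real.log n⌉₊ ≤ Real.exp (-(1 / 2) * Real.log n) := by
    rw [← Real.exp_log hq0, ← Real.exp_nat_mul, Real.exp_le_exp]
    refine (mul_le_mul_of_nonpos_right (Nat.le_ceil _) hlogq.le).trans_eq ?_
    rw [mul_right_comm, hAq]
  refine h1.trans_eq ?_
  rw [show -(1 / 2) * Real.log n = -(Real.log n / 2) by ring, ← Real.log_sqrt hnpos.le,
    Real.exp_neg, Real.exp_log (Real.sqrt_pos.2 hnpos), one_div]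

theorem third_pow_ceil_mul_log_le {n : ℕ} (hn : 1 ≤ n) :
    ((1 : ℝ) / 3) ^ ⌈3 * Real.log n⌉₊ ≤ 1 / n ^ 3 := by
  have hnpos : (0 : ℝ) < n := by exact_mod_cast hn
  have h3 : (1 : ℝ) / 3 ≤ Real.exp (-1) := by
    rw [Real.exp_neg, ← one_div]
    exact one_div_le_one_div_of_le (Real.exp_pos 1) Real.exp_one_lt_three.le
  calc ((1 : ℝ) / 3) ^ ⌈3 * Real.log n⌉₊ ≤ Real.exp (-1) ^ ⌈3 * Real.log n⌉₊ := by gcongr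
    _ = Real.exp (-⌈3 * Real.log n⌉₊) := by rw [← Real.exp_nat_mul]; ring_nf
    _ ≤ Real.exp (-(3 * Real.log n)) := Real.exp_le_exp.2 (neg_le_neg (Nat.le_ceil _))
    _ = 1 / n ^ 3 := by
      rw [Real.exp_neg, mul_comm, Real.exp_mul, Real.exp_log hnpos, one_div]
      norm_cast

/-- The union bound of `measureReal_iUnion_largeComponent_le` is polylogarithmic over `√n`. -/
theorem sq_mul_failure_le {n j : ℕ} (hn : 1 ≤ n) {b l G : ℝ} (hl : 1 ≤ l) (hG0 : 0 ≤ G)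
    (hG : G ≤ 2 * b ^ 6 * (l ^ 12 / Real.sqrt n)) (hj : ((1 : ℝ) / 3) ^ j ≤ 1 / n ^ 3) :
    (n : ℝ) ^ 2 * ((2 * G) ^ 5 + (1 / 3) ^ j) ≤
      (4 ^ 5 * b ^ 30 + 1) * (l ^ 60 / Real.sqrt n) := by
  have hn1 : (1 : ℝ) ≤ n := by exact_mod_cast hn
  obtain ⟨r, hr⟩ : ∃ r, r = Real.sqrt n := ⟨_, rfl⟩
  rw [← hr] at hG ⊢
  have hr2 : (n : ℝ) = r ^ 2 := by rw [hr, Real.sq_sqrt (by linarith)]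
  have hr1 : 1 ≤ r := by rw [hr]; exact Real.one_le_sqrt.2 hn1
  have hr0 : 0 < r := by linarith
  rw [hr2] at hj ⊢
  have hfive : (r ^ 2) ^ 2 * (2 * G) ^ 5 ≤ 4 ^ 5 * b ^ 30 * (l ^ 60 / r) := by
    calc (r ^ 2) ^ 2 * (2 * G) ^ 5
        ≤ (r ^ 2) ^ 2 * (2 * (2 * b ^ 6 * (l ^ 12 / r))) ^ 5 := by gcongr
      _ = 4 ^ 5 * b ^ 30 * (l ^ 60 / r) := by field_simp; ring
  have hthird : (r ^ 2) ^ 2 * (1 / 3) ^ j ≤ l ^ 60 / r := by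
    calc (r ^ 2) ^ 2 * (1 / 3) ^ j ≤ (r ^ 2) ^ 2 * (1 / (r ^ 2) ^ 3) := by gcongr
      _ = 1 / (r * r) := by field_simp
      _ ≤ 1 / r := one_div_le_one_div_of_le hr0 (le_mul_of_one_le_left hr0.le hr1)
      _ ≤ _ := div_le_div_of_nonneg_right (one_le_pow₀ hl) hr0.le
  rw [mul_add]
  linarith

/-- Outside an event of probability polylogarithmic over `√n`, all components have at most
polylogarithmically many pairs. -/
theorem exists_measureReal_largeComponent_le {lam : ℝ} (h0 : 0 ≤ lam) (hlam : lam < lambdaC)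
    {p : ℕ → ℝ} (hp0 : ∀ n, 0 ≤ p n) (hp : ∀ n : ℕ, 1 ≤ n → p n ≤ lam / Real.sqrt n) :
    ∃ B : ℝ, 0 < B ∧ ∀ᶠ n : ℕ in atTop, p n ≤ 1 ∧ ∃ T : ℕ, (T : ℝ) ≤ B * Real.log n ^ 8 ∧
      (erMeasure n (p n)).real (⋃ e : Sym2 (Fin n), largeComponent e T) ≤
        B * (Real.log n ^ 60 / Real.sqrt n) := by
  have hrho := two_mul_sq_add_lt_one h0 hlam
  have hlam1 : lam ≤ 1 := by nlinarith [sq_nonneg (lam ^ 2)]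
  have hlam2 : lam ^ 2 ≤ 1 / 2 := by nlinarith [sq_nonneg (lam ^ 2)]
  set q : ℝ := max (2 * lam ^ 2 + (lam ^ 2) ^ 2 / 2) (1 / 2) with hqdef
  have hq1 : q < 1 := max_lt hrho (by norm_num)
  have hq0 : 0 < q := lt_max_of_lt_right (by norm_num)
  have hlogq : Real.log q < 0 := Real.log_neg hq0 hq1
  set A : ℝ := 1 / (-(2 * Real.log q)) with hA
  have hA0 : 0 < A := by rw [hA]; apply one_div_pos.2; linarith
  have hAq : A * Real.log q = -(1 / 2) := by
    rw [hA]
    field_simp [hlogq.ne]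
  set b : ℝ := 2 + 18 * (A + 2) with hb
  have hb0 : 0 < b := by positivity
  have hb1 : 1 ≤ b := by linarith
  have hsmall : ∀ᶠ n : ℕ in atTop, 2 * b ^ 6 * (Real.log n ^ 12 / Real.sqrt n) < 1 / 2 := by
    have h := (tendsto_log_pow_div_sqrt 12).const_mul (2 * b ^ 6)
    rw [mul_zero] at h
    exact h.eventually_lt_const (by norm_num)
  have hlog : ∀ᶠ n : ℕ in atTop, 1 ≤ Real.log n :=
    (Real.tendsto_log_atTop.comp tendsto_natCast_atTop_atTop).eventually_ge_atTop 1
  refine ⟨4 ^ 5 * b ^ 30 + 7 * b ^ 4 + 1, by positivity, ?_⟩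
  filter_upwards [hsmall, hlog, eventually_ge_atTop 1] with n hGn hlogn hn
  set l := Real.log n with hl
  have hnpos : (0 : ℝ) < n := by exact_mod_cast hn
  have hn1 : (1 : ℝ) ≤ n := by exact_mod_cast hn
  set r := Real.sqrt n with hr
  have hr2 : r ^ 2 = n := Real.sq_sqrt hnpos.le
  have hr1 : 1 ≤ r := Real.one_le_sqrt.2 hn1
  have hr0 : 0 < r := by linarith
  have hpr : p n ≤ 1 / r := (hp n hn).trans (by gcongr)
  have hpn1 : p n ≤ 1 := hpr.trans ((div_le_one hr0).2 hr1)
  have hx : n * p n ^ 2 ≤ lam ^ 2 := by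
    have h := (le_div_iff₀ hr0).1 (hp n hn)
    rw [← hr2]
    have h2 : 0 ≤ p n * r := mul_nonneg (hp0 n) hr0.le
    nlinarith
  have hx0 : 0 ≤ n * p n ^ 2 := by positivity
  have hq : 2 * (n * p n ^ 2) + (n * p n ^ 2) ^ 2 / 2 ≤ q := by
    refine le_trans ?_ (le_max_left _ _)
    gcongr
  set L := ⌈A * l⌉₊ with hL
  set j := ⌈3 * l⌉₊ with hj
  set M := 2 + 2 * (L + 1) * (j + 5) with hM
  have hLle : (L : ℝ) + 1 ≤ (A + 2) * l := by
    have := Nat.ceil_lt_add_one (show 0 ≤ A * l by positivity)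
    rw [← hL] at this
    linarith
  have hjle : (j : ℝ) + 5 ≤ 9 * l := by
    have := Nat.ceil_lt_add_one (show 0 ≤ 3 * l by positivity)
    rw [← hj] at this
    linarith
  have hMle : (M : ℝ) ≤ b * l ^ 2 := by
    have h1 : ((L : ℝ) + 1) * (j + 5) ≤ (A + 2) * l * (9 * l) := by gcongr
    have h2 : (1 : ℝ) ≤ l ^ 2 := one_le_pow₀ hlogn
    rw [hM]
    push_cast
    rw [hb]
    nlinarith
  have hM1 : (1 : ℝ) ≤ M := by exact_mod_cast (show 1 ≤ M by omega)
  have hqL : q ^ L ≤ 1 / r := pow_ceil_mul_log_le hn hq0 hlogq hAq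
  have hj3 : ((1 : ℝ) / 3) ^ j ≤ 1 / n ^ 3 := third_pow_ceil_mul_log_le hn
  set G : ℝ := 2 * M ^ 6 / r with hGdef
  have hG : (M : ℝ) ^ 6 * p n + (M : ℝ) ^ 3 * q ^ L ≤ G := by
    have h36 : (M : ℝ) ^ 3 ≤ (M : ℝ) ^ 6 := pow_le_pow_right₀ hM1 (by norm_num)
    calc _ ≤ (M : ℝ) ^ 6 * (1 / r) + (M : ℝ) ^ 6 * (1 / r) := by gcongr
      _ = G := by rw [hGdef]; ring
  have hGle : G ≤ 2 * b ^ 6 * (l ^ 12 / r) := by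
    calc G ≤ 2 * (b * l ^ 2) ^ 6 / r := by rw [hGdef]; gcongr
      _ = _ := by ring
  have hG0 : 0 ≤ G := by positivity
  refine ⟨hpn1, M ^ 2 + 6 * M ^ 4, ?_, ?_⟩
  · have h24 : (M : ℝ) ^ 2 ≤ (M : ℝ) ^ 4 := pow_le_pow_right₀ hM1 (by norm_num)
    push_cast
    calc (M : ℝ) ^ 2 + 6 * (M : ℝ) ^ 4 ≤ 7 * (M : ℝ) ^ 4 := by linarith
      _ ≤ 7 * (b * l ^ 2) ^ 4 := by gcongr
      _ = 7 * b ^ 4 * l ^ 8 := by ring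
      _ ≤ _ := by
        gcongr
        have : 0 ≤ 4 ^ 5 * b ^ 30 := by positivity
        linarith
  · refine (measureReal_iUnion_largeComponent_le (hp0 n) hpn1 (hx.trans hlam2) hq hq1.le hM hG
      (hGle.trans hGn.le)).trans ?_
    refine (sq_mul_failure_le hn hlogn hG0 hGle hj3).trans ?_
    have : 0 ≤ 7 * b ^ 4 := by positivity
    gcongr
    linarith

/-- **Subcritical behaviour.** If `λ < λ_c` is fixed and `p(n) ≤ λ n^{-1/2}`, then a.a.s.
every square-component of `Γ ∈ G(n,p)` covers at most `C (log n)^{2^32}` vertices. -/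
theorem subcritical_small_square_components
    (lam : ℝ) (hlam : lam < lambdaC)
    (p : ℕ → ℝ) (hp0 : ∀ n, 0 ≤ p n)
    (hp : ∀ n : ℕ, 1 ≤ n → p n ≤ lam / Real.sqrt n) :
    ∃ C : ℝ, 0 < C ∧
      Tendsto
        (fun n : ℕ => erMeasure n (p n)
          {ω | ∀ e : Sym2 (Fin n), IsNonEdge (graphOf ω) e →
            ((suppOf (squareComponent (graphOf ω) e)).ncard : ℝ)
              ≤ C * Real.log n ^ (2 ^ 32 : ℕ)})
        atTop (nhds 1) := by
  have h0 : 0 ≤ lam := by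
    have h := (hp0 1).trans (hp 1 le_rfl)
    simpa using h
  obtain ⟨B, hB, hev⟩ := exists_measureReal_largeComponent_le h0 hlam hp0 hp
  refine ⟨2 * B, by positivity, ?_⟩
  have hlog : ∀ᶠ n : ℕ in atTop, 1 ≤ Real.log n :=
    (Real.tendsto_log_atTop.comp tendsto_natCast_atTop_atTop).eventually_ge_atTop 1
  have hlim : Tendsto (fun n : ℕ => ENNReal.ofReal (1 - B * (Real.log n ^ 60 / Real.sqrt n)))
      atTop (nhds 1) := by
    have h := ((tendsto_log_pow_div_sqrt 60).const_mul B).const_sub 1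
    rw [mul_zero, sub_zero] at h
    simpa using ENNReal.tendsto_ofReal h
  refine tendsto_of_tendsto_of_tendsto_of_le_of_le' hlim tendsto_const_nhds ?_ ?_
  · filter_upwards [hev, hlog] with n hn hlogn
    obtain ⟨hp1, T, hT, hbad⟩ := hn
    have := isProbabilityMeasure_erMeasure n (hp0 n) hp1
    set U := ⋃ e : Sym2 (Fin n), largeComponent e T
    have hcompl : (erMeasure n (p n)).real Uᶜ = 1 - (erMeasure n (p n)).real U :=
      probReal_compl_eq_one_sub U.toFinite.measurableSet
    refine le_trans ?_ (measure_mono (s := Uᶜ) fun ω hω e _ => ?_)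
    · rw [← ofReal_measureReal, hcompl]
      exact ENNReal.ofReal_le_ofReal (by linarith)
    · have hle : (squareComponent (graphOf ω) e).ncard ≤ T := by
        by_contra hlt
        exact hω (Set.mem_iUnion.2 ⟨e, not_le.1 hlt⟩)
      have hsupp := (ncard_suppOf_le (squareComponent (graphOf ω) e)).trans
        (Nat.mul_le_mul_left 2 hle)
      calc ((suppOf (squareComponent (graphOf ω) e)).ncard : ℝ) ≤ 2 * T := by exact_mod_cast hsupp
        _ ≤ 2 * (B * Real.log n ^ 8) := by gcongr
        _ = 2 * B * Real.log n ^ 8 := by ring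
        _ ≤ 2 * B * Real.log n ^ (2 ^ 32 : ℕ) := by
          have h8 : 8 ≤ (2 ^ 32 : ℕ) := by norm_num
          exact mul_le_mul_of_nonneg_left (pow_le_pow_right₀ hlogn h8) (by positivity)
  · filter_upwards [hev] with n hn
    have := isProbabilityMeasure_erMeasure n (hp0 n) hn.1
    exact prob_le_one
end
end

section
/- Let λ < λ_c be fixed, let p = λ n^{-1/2}, and let ε > 0 be a constant such that E[(Z² + 3Z)/2] ≤ 1 − ε for Z ~ Binom(n, p²) and all n. Set k₀ = ⌈2^{26} ε^{-2} (log n)^5⌉. For each k, let X₁, …, X_k be independent random variables, each distributed as (Z² + 3Z)/2 with Z ~ Binom(n, p²). Then ∑_{k ≥ k₀} (1/k)·P( X₁ + X₂ + ⋯ + X_k = k − 1 ) = O(n^{-5}). (By Dwass's formula, this sum is exactly P(W ≥ k₀), where W is the total progeny of the Galton–Watson branching process with offspring distribution (Z²+3Z)/2; in particular this branching process is subcritical and its total progeny exceeds k₀ with probability O(n^{-5}).) -/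
open MeasureTheory Filter
open scoped ENNReal

noncomputable section

/-- The expectation of `f(Z)` for `Z ~ Binom(n, q)`. -/
def binomExp (n : ℕ) (q : ℝ) (f : ℕ → ℝ) : ℝ :=
  ∑ k ∈ Finset.range (n + 1), (n.choose k : ℝ) * q ^ k * (1 - q) ^ (n - k) * f k

/-- The binomial distribution `Binom(n, q)` as a measure on `ℕ`. -/
def binomMeasure (n : ℕ) (q : ℝ) : Measure ℕ :=
  Measure.sum fun k : Fin (n + 1) =>
    ENNReal.ofReal ((n.choose k : ℝ) * q ^ (k : ℕ) * (1 - q) ^ (n - (k : ℕ))) •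
      Measure.dirac (k : ℕ)

/-- The offspring value `(z² + 3z)/2 = C(z+2, 2) - 1` (a natural number). -/
def offspring (z : ℕ) : ℕ := z * (z + 3) / 2

theorem lintegral_binomMeasure {n : ℕ} {q : ℝ} (hq0 : 0 ≤ q) (hq1 : q ≤ 1) {f : ℕ → ℝ}
    (hf : ∀ z, 0 ≤ f z) :
    ∫⁻ z, ENNReal.ofReal (f z) ∂binomMeasure n q = ENNReal.ofReal (binomExp n q f) := by
  have h1 : 0 ≤ 1 - q := by linarith
  rw [binomMeasure, lintegral_sum_measure, tsum_fintype, binomExp, Finset.sum_range,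
    ENNReal.ofReal_sum_of_nonneg]
  swap
  · exact fun i _ => mul_nonneg (by positivity) (hf i)
  refine Finset.sum_congr rfl fun i _ => ?_
  rw [lintegral_smul_measure, lintegral_dirac, smul_eq_mul, ← ENNReal.ofReal_mul (by positivity)]

theorem binomExp_mono {n : ℕ} {q : ℝ} (hq0 : 0 ≤ q) (hq1 : q ≤ 1) {f g : ℕ → ℝ}
    (hfg : ∀ z, f z ≤ g z) : binomExp n q f ≤ binomExp n q g := by
  have h1 : 0 ≤ 1 - q := by linarith
  exact Finset.sum_le_sum fun i _ => mul_le_mul_of_nonneg_left (hfg i) (by positivity)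

theorem binomExp_add (n : ℕ) (q : ℝ) (f g : ℕ → ℝ) :
    binomExp n q (fun z => f z + g z) = binomExp n q f + binomExp n q g := by
  simp only [binomExp, mul_add, Finset.sum_add_distrib]

theorem binomExp_const_mul (n : ℕ) (q c : ℝ) (f : ℕ → ℝ) :
    binomExp n q (fun z => c * f z) = c * binomExp n q f := by
  simp only [binomExp, Finset.mul_sum]
  exact Finset.sum_congr rfl fun i _ => by ring

theorem binomExp_pow (n : ℕ) (q a : ℝ) :
    binomExp n q (fun z => a ^ z) = (q * a + (1 - q)) ^ n := by
  rw [add_pow, binomExp]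
  exact Finset.sum_congr rfl fun i _ => by rw [mul_pow]; ring

theorem binomExp_one (n : ℕ) (q : ℝ) : binomExp n q (fun _ => 1) = 1 := by
  simpa using binomExp_pow n q 1

theorem isProbabilityMeasure_binomMeasure {n : ℕ} {q : ℝ} (hq0 : 0 ≤ q) (hq1 : q ≤ 1) :
    IsProbabilityMeasure (binomMeasure n q) := by
  constructor
  have h := lintegral_binomMeasure (n := n) hq0 hq1 (f := fun _ => 1) fun _ => zero_le_one
  rw [binomExp_one] at h
  simpa using h

/-- The exponential moments of `Binom(n, c / n)` are bounded uniformly in `n`. -/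
theorem binomExp_exp_mul_le {n : ℕ} (hn : 0 < n) {c t : ℝ} (hc0 : 0 ≤ c) (hc1 : c ≤ 1) :
    binomExp n (c / n) (fun z => Real.exp (t * z)) ≤ Real.exp (c * Real.exp t) := by
  have hn' : (1 : ℝ) ≤ n := by exact_mod_cast hn
  have hq0 : 0 ≤ c / n := by positivity
  have hq1 : c / n ≤ 1 := (div_le_one (by positivity)).2 (hc1.trans hn')
  have h1 : 0 ≤ 1 - c / n := by linarith
  have hfun : (fun z : ℕ => Real.exp (t * z)) = fun z => Real.exp t ^ z := by
    funext z
    rw [← Real.exp_nat_mul, mul_comm]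
  rw [hfun, binomExp_pow]
  calc (c / n * Real.exp t + (1 - c / n)) ^ n ≤ Real.exp (c / n * Real.exp t) ^ n := by
        gcongr
        linarith [Real.add_one_le_exp (c / n * Real.exp t)]
    _ = Real.exp (c * Real.exp t) := by
        rw [← Real.exp_nat_mul]
        congr 1
        field_simp

theorem offspring_cast (z : ℕ) : (offspring z : ℝ) = ((z : ℝ) ^ 2 + 3 * z) / 2 := by
  have h2 : 2 ∣ z * (z + 3) := by
    rcases Nat.even_or_odd z with h | h
    · exact (h.two_dvd).mul_right _
    · exact ((h.add_odd (by decide : Odd 3)).two_dvd).mul_left _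
  rw [offspring, Nat.cast_div h2 (by norm_num)]
  push_cast
  ring

theorem exp_le_one_add_add_sq_mul_exp {y : ℝ} (hy : 0 ≤ y) :
    Real.exp y ≤ 1 + y + y ^ 2 * Real.exp y := by
  have h : Real.exp y ≤ 1 + y * Real.exp y := by
    have h1 := Real.add_one_le_exp (-y)
    have h2 : Real.exp (-y) * Real.exp y = 1 := by rw [← Real.exp_add]; simp
    nlinarith [Real.exp_pos y]
  nlinarith

/-- The exponential tilt of the offspring value at parameter `k^{-1/2}`, truncated to the
values `z` with `z² ≤ 2k`. -/
def truncatedTilt (k z : ℕ) : ℝ :=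
  if z ^ 2 ≤ 2 * k then Real.exp ((√k)⁻¹ * offspring z) else 0

theorem truncatedTilt_nonneg (k z : ℕ) : 0 ≤ truncatedTilt k z := by
  unfold truncatedTilt
  split_ifs <;> positivity

theorem truncatedTilt_le {k : ℕ} (hk : 0 < k) (z : ℕ) :
    truncatedTilt k z ≤
      1 + ((√k)⁻¹ * (((z : ℝ) ^ 2 + 3 * z) / 2) + (k : ℝ)⁻¹ * Real.exp (9 * z)) := by
  have hz : (0 : ℝ) ≤ z := z.cast_nonneg
  unfold truncatedTilt
  split_ifs with h
  · have hk1 : (1 : ℝ) ≤ k := by exact_mod_cast hk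
    have hs1 : 1 ≤ √(k : ℝ) := Real.one_le_sqrt.2 hk1
    have hsq : √(k : ℝ) ^ 2 = k := Real.sq_sqrt (by positivity)
    have hzk : (z : ℝ) ^ 2 ≤ 2 * k := by exact_mod_cast h
    have hzs : (z : ℝ) ≤ 2 * √k := by
      apply le_of_sq_le_sq _ (by positivity)
      nlinarith
    rw [offspring_cast]
    set X : ℝ := ((z : ℝ) ^ 2 + 3 * z) / 2 with hX
    have hX0 : 0 ≤ X := by positivity
    have hy : (√(k : ℝ))⁻¹ * X ≤ 3 * z := by
      rw [inv_mul_le_iff₀ (by positivity)]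
      nlinarith
    have hX3 : X ≤ Real.exp (3 * z) := by
      have := Real.quadratic_le_exp_of_nonneg (x := 3 * (z : ℝ)) (by positivity)
      nlinarith
    have hexp := exp_le_one_add_add_sq_mul_exp (y := (√(k : ℝ))⁻¹ * X) (by positivity)
    have hrem : ((√(k : ℝ))⁻¹ * X) ^ 2 * Real.exp ((√(k : ℝ))⁻¹ * X) ≤
        (k : ℝ)⁻¹ * Real.exp (9 * z) := by
      calc ((√(k : ℝ))⁻¹ * X) ^ 2 * Real.exp ((√(k : ℝ))⁻¹ * X)
          ≤ ((√(k : ℝ))⁻¹ * Real.exp (3 * z)) ^ 2 * Real.exp (3 * z) := by gcongr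
        _ = (k : ℝ)⁻¹ * Real.exp (9 * z) := by
            rw [mul_pow, inv_pow, hsq, mul_assoc, ← pow_succ, ← Real.exp_nat_mul]
            congr 2
            push_cast
            ring
    linarith
  · positivity

theorem binomExp_truncatedTilt_le {n k : ℕ} (hn : 0 < n) (hk : 0 < k) {c ε : ℝ} (hc0 : 0 ≤ c)
    (hc1 : c ≤ 1)
    (hmean : binomExp n (c / n) (fun z => ((z : ℝ) ^ 2 + 3 * z) / 2) ≤ 1 - ε) :
    binomExp n (c / n) (truncatedTilt k) ≤
      Real.exp ((√k)⁻¹ * (1 - ε) + (k : ℝ)⁻¹ * Real.exp (c * Real.exp 9)) := by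
  have hn' : (1 : ℝ) ≤ n := by exact_mod_cast hn
  have hq0 : 0 ≤ c / n := by positivity
  have hq1 : c / n ≤ 1 := (div_le_one (by positivity)).2 (hc1.trans hn')
  have h := binomExp_mono (n := n) hq0 hq1 (truncatedTilt_le hk)
  rw [binomExp_add, binomExp_one, binomExp_add, binomExp_const_mul, binomExp_const_mul] at h
  calc _ ≤ _ := h
    _ ≤ (√k)⁻¹ * (1 - ε) + (k : ℝ)⁻¹ * Real.exp (c * Real.exp 9) + 1 := by
        rw [add_comm]
        gcongr
        exact binomExp_exp_mul_le hn hc0 hc1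
    _ ≤ _ := Real.add_one_le_exp _

theorem indicator_le_prod_truncatedTilt {k : ℕ} (hk : 0 < k) (x : Fin k → ℕ) :
    {x : Fin k → ℕ | ∑ i, offspring (x i) = k - 1}.indicator 1 x ≤
      ENNReal.ofReal (Real.exp (-((√k)⁻¹ * (k - 1)))) *
        ∏ i, ENNReal.ofReal (truncatedTilt k (x i)) := by
  refine Set.indicator_apply_le' (fun hx => ?_) (fun _ => zero_le)
  have hx' : ∑ i, offspring (x i) = k - 1 := hx
  have htilt (i : Fin k) : truncatedTilt k (x i) = Real.exp ((√k)⁻¹ * offspring (x i)) := by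
    refine if_pos ?_
    have h1 : offspring (x i) ≤ k - 1 :=
      hx' ▸ Finset.single_le_sum (f := fun i => offspring (x i)) (fun _ _ => Nat.zero_le _)
        (Finset.mem_univ i)
    have h2 : (offspring (x i) : ℝ) ≤ k := by exact_mod_cast h1.trans (Nat.sub_le k 1)
    rw [offspring_cast] at h2
    have h3 : ((x i : ℕ) : ℝ) ^ 2 ≤ 2 * k := by
      linarith [(x i).cast_nonneg (α := ℝ)]
    exact_mod_cast h3
  have hsum : ∑ i, (offspring (x i) : ℝ) = k - 1 := by
    rw [← Nat.cast_sum, hx', Nat.cast_sub hk, Nat.cast_one]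
  rw [← ENNReal.ofReal_prod_of_nonneg fun i _ => truncatedTilt_nonneg k (x i),
    ← ENNReal.ofReal_mul (Real.exp_nonneg _), Finset.prod_congr rfl fun i _ => htilt i,
    ← Real.exp_sum, ← Finset.mul_sum, hsum, ← Real.exp_add]
  simp

/-- A subcritical sum of `k` offspring values equals `k - 1` with probability
`O(exp(-ε√k))`, uniformly in `n`. -/
theorem pi_sum_offspring_eq_le {n k : ℕ} (hn : 0 < n) (hk : 0 < k) {c ε : ℝ} (hc0 : 0 ≤ c)
    (hc1 : c ≤ 1)
    (hmean : binomExp n (c / n) (fun z => ((z : ℝ) ^ 2 + 3 * z) / 2) ≤ 1 - ε) :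
    (Measure.pi fun _ : Fin k => binomMeasure n (c / n)) {x | (∑ i, offspring (x i)) = k - 1} ≤
      ENNReal.ofReal (Real.exp (1 + Real.exp (c * Real.exp 9)) * Real.exp (-(ε * √k))) := by
  have hn' : (1 : ℝ) ≤ n := by exact_mod_cast hn
  have hk1 : (1 : ℝ) ≤ k := by exact_mod_cast hk
  have hq0 : 0 ≤ c / n := by positivity
  have hq1 : c / n ≤ 1 := (div_le_one (by positivity)).2 (hc1.trans hn')
  have := isProbabilityMeasure_binomMeasure (n := n) hq0 hq1
  have hind : ProbabilityTheory.iIndepFun (fun (i : Fin k) (x : Fin k → ℕ) => ENNReal.ofReal (truncatedTilt k (x i)))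
      (Measure.pi fun _ : Fin k => binomMeasure n (c / n)) :=
    ProbabilityTheory.iIndepFun_pi (X := fun _ z => ENNReal.ofReal (truncatedTilt k z))
      fun _ => (Measurable.of_discrete).aemeasurable
  have hmeas : MeasurableSet {x : Fin k → ℕ | (∑ i, offspring (x i)) = k - 1} :=
    (Set.to_countable _).measurableSet
  have hcoord (i : Fin k) :
      ∫⁻ x, ENNReal.ofReal (truncatedTilt k (x i))
        ∂(Measure.pi fun _ : Fin k => binomMeasure n (c / n)) =
      ENNReal.ofReal (binomExp n (c / n) (truncatedTilt k)) := by
    rw [← lintegral_binomMeasure hq0 hq1 (truncatedTilt_nonneg k)]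
    exact (measurePreserving_eval (fun _ : Fin k => binomMeasure n (c / n)) i).lintegral_comp
      (f := fun z => ENNReal.ofReal (truncatedTilt k z)) Measurable.of_discrete
  rw [← lintegral_indicator_one hmeas]
  refine (lintegral_mono (indicator_le_prod_truncatedTilt hk)).trans ?_
  rw [lintegral_const_mul _ (Measurable.of_discrete),
    ProbabilityTheory.lintegral_prod_eq_prod_lintegral_of_indepFun _ _ hind fun _ => Measurable.of_discrete,
    Finset.prod_congr rfl fun i _ => hcoord i, Finset.prod_const, Finset.card_univ,
    Fintype.card_fin]
  have hB := binomExp_truncatedTilt_le hn hk hc0 hc1 hmean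
  calc _ ≤ ENNReal.ofReal (Real.exp (-((√k)⁻¹ * (k - 1)))) * ENNReal.ofReal
        (Real.exp ((√k)⁻¹ * (1 - ε) + (k : ℝ)⁻¹ * Real.exp (c * Real.exp 9))) ^ k := by
        gcongr
    _ ≤ _ := by
        rw [← ENNReal.ofReal_pow (Real.exp_nonneg _), ← ENNReal.ofReal_mul (Real.exp_nonneg _),
          ← Real.exp_nat_mul, ← Real.exp_add, ← Real.exp_add]
        refine ENNReal.ofReal_le_ofReal (Real.exp_le_exp.2 ?_)
        have hinv : (√(k : ℝ))⁻¹ ≤ 1 := inv_le_one_of_one_le₀ (Real.one_le_sqrt.2 hk1)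
        have hks : (k : ℝ) * (√(k : ℝ))⁻¹ = √k := by
          rw [← div_eq_mul_inv, Real.div_sqrt]
        have hkk : (k : ℝ) * (k : ℝ)⁻¹ = 1 := mul_inv_cancel₀ (by positivity)
        linear_combination hinv + (-ε) * hks + Real.exp (c * Real.exp 9) * hkk

theorem summable_exp_neg_mul_sqrt {a : ℝ} (ha : 0 < a) :
    Summable fun k : ℕ => Real.exp (-(a * √k)) := by
  refine summable_of_isBigO_nat (Real.summable_nat_rpow.mpr (by norm_num : (-2 : ℝ) < -1)) ?_
  have h := ((isLittleO_exp_neg_mul_rpow_atTop ha (-4)).isBigO.comp_tendsto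
    (Real.tendsto_sqrt_atTop.comp tendsto_natCast_atTop_atTop))
  refine (h.congr_left fun k => by simp [neg_mul]).congr_right fun k => ?_
  simp only [Function.comp_apply, Real.sqrt_eq_rpow]
  rw [← Real.rpow_mul (Nat.cast_nonneg k)]
  norm_num

theorem lambdaC_le_one : lambdaC ≤ 1 := by
  rw [lambdaC, Real.sqrt_le_one, sub_le_iff_le_add, Real.sqrt_le_iff]
  norm_num

theorem five_mul_log_le {ε L : ℝ} {k : ℕ} (hε : 0 < ε) (hL : 1 ≤ L)
    (hk : (2 : ℝ) ^ 26 * ε⁻¹ ^ 2 * L ^ 5 ≤ k) : 5 * L ≤ ε / 2 * √k := by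
  have h : 2 ^ 13 * ε⁻¹ * L ≤ √k := by
    refine Real.le_sqrt_of_sq_le (le_trans ?_ hk)
    calc (2 ^ 13 * ε⁻¹ * L) ^ 2 = (2 : ℝ) ^ 26 * ε⁻¹ ^ 2 * L ^ 2 := by ring
      _ ≤ _ := by gcongr; norm_num
  calc 5 * L ≤ ε / 2 * (2 ^ 13 * ε⁻¹ * L) := by
        field_simp
        norm_num
    _ ≤ _ := by gcongr

/-- **Total progeny of the subcritical branching process.**  With `p = λ n^{-1/2}`,
`λ < λ_c` fixed, and `ε > 0` such that the offspring distribution `(Z²+3Z)/2`,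
`Z ~ Binom(n, p²)`, has mean at most `1 - ε` for all `n`, setting
`k₀ = ⌈2^26 ε⁻² (log n)^5⌉`, the sum over `k ≥ k₀` of `(1/k)·P(X₁ + ⋯ + X_k = k - 1)`
for i.i.d. copies `X_i` of the offspring distribution is `O(n⁻⁵)`.  (By Dwass's formula
this sum is the probability that the total progeny of the associated Galton–Watson
process is at least `k₀`.) -/
theorem dwass_total_progeny_bound
    (lam ε : ℝ) (hlam0 : 0 ≤ lam) (hlam : lam < lambdaC) (hε : 0 < ε)
    (hεmean : ∀ n : ℕ, 0 < n →
      binomExp n (lam ^ 2 / n) (fun z => ((z : ℝ) ^ 2 + 3 * z) / 2) ≤ 1 - ε) :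
    ∃ C : ℝ, 0 < C ∧ ∀ᶠ n : ℕ in atTop,
      (∑' k : ℕ,
        if ⌈(2 : ℝ) ^ 26 * ε⁻¹ ^ 2 * Real.log n ^ 5⌉₊ ≤ k then
          (k : ℝ≥0∞)⁻¹ *
            (Measure.pi fun _ : Fin k => binomMeasure n (lam ^ 2 / n))
              {x | (∑ i, offspring (x i)) = k - 1}
        else 0)
      ≤ ENNReal.ofReal (C * (n : ℝ)⁻¹ ^ 5) := by
  have hc1 : lam ^ 2 ≤ 1 := pow_le_one₀ hlam0 (hlam.le.trans lambdaC_le_one)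
  have hsum := summable_exp_neg_mul_sqrt (half_pos hε)
  set A : ℝ := Real.exp (1 + Real.exp (lam ^ 2 * Real.exp 9))
  set S : ℝ := ∑' k : ℕ, Real.exp (-(ε / 2 * √k))
  have hS0 : 0 < S := hsum.tsum_pos (fun _ => Real.exp_nonneg _) 0 (Real.exp_pos _)
  refine ⟨A * S, by positivity, ?_⟩
  filter_upwards [(Real.tendsto_log_atTop.comp tendsto_natCast_atTop_atTop).eventually_ge_atTop 1,
    eventually_gt_atTop 0] with n hL hn
  have hL : 1 ≤ Real.log n := hL
  have hn0 : (0 : ℝ) < n := by exact_mod_cast hn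
  have hpow : Real.exp (-(5 * Real.log n)) = (n : ℝ)⁻¹ ^ 5 := by
    rw [← mul_neg, ← Real.log_inv, show (5 : ℝ) = (5 : ℕ) by norm_num, Real.exp_nat_mul,
      Real.exp_log (inv_pos.2 hn0)]
  have hterm : A * S * (n : ℝ)⁻¹ ^ 5 =
      ∑' k : ℕ, A * (n : ℝ)⁻¹ ^ 5 * Real.exp (-(ε / 2 * √k)) := by
    rw [tsum_mul_left]
    ring
  rw [hterm, ENNReal.ofReal_tsum_of_nonneg (fun _ => by positivity) (hsum.mul_left _)]
  refine ENNReal.tsum_le_tsum fun k => ?_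
  split_ifs with hk
  swap
  · exact zero_le
  have hk' := Nat.ceil_le.1 hk
  have hk0 : 0 < k := by
    have : (0 : ℝ) < k := lt_of_lt_of_le (by positivity) hk'
    exact_mod_cast this
  have hkinv : (k : ℝ≥0∞)⁻¹ ≤ 1 := ENNReal.inv_le_one.2 (by exact_mod_cast hk0)
  refine (mul_le_of_le_one_left zero_le hkinv).trans
    ((pi_sum_offspring_eq_le hn hk0 (sq_nonneg lam) hc1 (hεmean n hn)).trans
      (ENNReal.ofReal_le_ofReal ?_))
  rw [← hpow, mul_assoc A, ← Real.exp_add (-(5 * Real.log n))]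
  refine mul_le_mul_of_nonneg_left (Real.exp_le_exp.2 ?_) (Real.exp_nonneg _)
  linarith [five_mul_log_le hε hL hk']
end
end
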